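/- Let K ≥ 2 be an integer, let E ∈ ℝ, and let a_1, …, a_m be real numbers with |E − a_k| < √K for every k; let A_E be the complex diagonal m×m matrix with entries (A_E)_{kk} = (1/(2K))·((E − a_k) − i·√(K − (E − a_k)²)). For assignments J, J′ of nonnegative integers to pairs 1 ≤ j ≤ k ≤ m, set λ_J = Π_{j≤k} (4·(A_E)_{jj}·(A_E)_{kk})^{J_{jk}} and similarly λ_{J′}. Then λ_J · conj(λ_{J′}) ≠ 1/K. -/

import Mathlib

/-- The diagonal entries of the matrix `A_E`:
`(A_E)_{kk} = (1/(2K))((E − a_k) − i√(K − (E − a_k)²))`. -/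
noncomputable def AEentry (K : ℕ) (E : ℝ) (ak : ℝ) : ℂ :=
  (1 / (2 * (K : ℂ))) * (((E : ℂ) - (ak : ℂ)) -
    Complex.I * (Real.sqrt ((K : ℝ) - (E - ak) ^ 2) : ℝ))

/-- The eigenvalue `λ_J = Π_{j≤k} (4 (A_E)_{jj} (A_E)_{kk})^{J_{jk}}` of the
operator `C_E`, indexed by an assignment `J` of nonnegative integers to pairs `j ≤ k`. -/
noncomputable def lambdaJ (K : ℕ) (E : ℝ) (m : ℕ) (a : Fin m → ℝ)
    (J : Fin m → Fin m → ℕ) : ℂ :=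
  ∏ p ∈ Finset.univ.filter (fun p : Fin m × Fin m => p.1 ≤ p.2),
    (4 * AEentry K E (a p.1) * AEentry K E (a p.2)) ^ J p.1 p.2

theorem AEentry_re (K : ℕ) (E b : ℝ) : (AEentry K E b).re = (E - b) / (2 * K) := by
  have h : AEentry K E b = ((1 / (2 * K) : ℝ) : ℂ) * (((E - b : ℝ) : ℂ) -
      Complex.I * (Real.sqrt ((K : ℝ) - (E - b) ^ 2) : ℝ)) := by
    simp [AEentry]
  rw [h, Complex.re_ofReal_mul]
  simp only [Complex.sub_re, Complex.ofReal_re, Complex.I_mul_re, Complex.ofReal_im]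
  ring

theorem AEentry_im (K : ℕ) (E b : ℝ) :
    (AEentry K E b).im = -Real.sqrt ((K : ℝ) - (E - b) ^ 2) / (2 * K) := by
  have h : AEentry K E b = ((1 / (2 * K) : ℝ) : ℂ) * (((E - b : ℝ) : ℂ) -
      Complex.I * (Real.sqrt ((K : ℝ) - (E - b) ^ 2) : ℝ)) := by
    simp [AEentry]
  rw [h, Complex.im_ofReal_mul]
  simp only [Complex.sub_im, Complex.ofReal_re, Complex.I_mul_im, Complex.ofReal_im]
  ring

theorem sq_lt_of_abs_lt_sqrt {x y : ℝ} (h : |x| < Real.sqrt y) : x ^ 2 < y := by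
  rw [← sq_abs]
  exact (Real.lt_sqrt (abs_nonneg x)).mp h

theorem normSq_AEentry {K : ℕ} (hK : 0 < K) {E b : ℝ} (h : |E - b| < Real.sqrt K) :
    Complex.normSq (AEentry K E b) = 1 / (4 * K) := by
  have hK' : (0 : ℝ) < K := by exact_mod_cast hK
  have hs := Real.sq_sqrt (sub_pos.mpr (sq_lt_of_abs_lt_sqrt h)).le
  rw [Complex.normSq_apply, AEentry_re, AEentry_im]
  field_simp
  linarith

theorem norm_four_mul_AEentry_mul_AEentry {K : ℕ} (hK : 0 < K) {E b c : ℝ}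
    (hb : |E - b| < Real.sqrt K) (hc : |E - c| < Real.sqrt K) :
    ‖4 * AEentry K E b * AEentry K E c‖ = 1 / K := by
  have hK' : (0 : ℝ) < K := by exact_mod_cast hK
  rw [← sq_eq_sq₀ (norm_nonneg _) (by positivity), ← Complex.normSq_eq_norm_sq, map_mul, map_mul,
    normSq_AEentry hK hb, normSq_AEentry hK hc, Complex.normSq_ofNat]
  field_simp

/-- Both factors lie in the open lower half-plane and have the same modulus, so their product is
not a positive real number. -/
theorem four_mul_AEentry_mul_AEentry_ne {K : ℕ} (hK : 0 < K) {E b c : ℝ}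
    (hb : |E - b| < Real.sqrt K) (hc : |E - c| < Real.sqrt K) :
    4 * AEentry K E b * AEentry K E c ≠ 1 / (K : ℂ) := by
  intro heq
  have hK' : (0 : ℝ) < K := by exact_mod_cast hK
  have hs := Real.sqrt_pos.mpr (sub_pos.mpr (sq_lt_of_abs_lt_sqrt hb))
  have ht := Real.sqrt_pos.mpr (sub_pos.mpr (sq_lt_of_abs_lt_sqrt hc))
  have heq' : ((4 : ℝ) : ℂ) * (AEentry K E b * AEentry K E c) = ((1 / K : ℝ) : ℂ) := by
    push_cast
    rw [← heq, mul_assoc]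
  have hre := congrArg Complex.re heq'
  have him := congrArg Complex.im heq'
  rw [Complex.re_ofReal_mul, Complex.mul_re, Complex.ofReal_re] at hre
  rw [Complex.im_ofReal_mul, Complex.mul_im, Complex.ofReal_im] at him
  simp only [AEentry_re, AEentry_im] at hre him
  generalize Real.sqrt ((K : ℝ) - (E - b) ^ 2) = s at *
  generalize Real.sqrt ((K : ℝ) - (E - c) ^ 2) = t at *
  generalize E - b = x at *
  generalize E - c = y at *
  have h1 : x * y - s * t = K := by
    field_simp at hre
    linarith
  have h2 : x * t + s * y = 0 := by
    field_simp at him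
    linarith
  have hxy : 0 < x * y := by nlinarith [mul_pos hs ht]
  have h3 : x ^ 2 * t + s * (x * y) = 0 := by linear_combination x * h2
  nlinarith [mul_pos hs hxy, mul_nonneg (sq_nonneg x) ht.le]

theorem norm_lambdaJ {K : ℕ} (hK : 0 < K) {E : ℝ} {m : ℕ} {a : Fin m → ℝ}
    (h : ∀ k, |E - a k| < Real.sqrt K) (J : Fin m → Fin m → ℕ) :
    ‖lambdaJ K E m a J‖ = (1 / K : ℝ) ^
      ∑ p ∈ Finset.univ.filter (fun p : Fin m × Fin m => p.1 ≤ p.2), J p.1 p.2 := by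
  rw [lambdaJ, norm_prod, ← Finset.prod_pow_eq_pow_sum]
  refine Finset.prod_congr rfl fun p _ => ?_
  rw [norm_pow, norm_four_mul_AEentry_mul_AEentry hK (h _) (h _)]

theorem lambdaJ_eq_one {K : ℕ} {E : ℝ} {m : ℕ} {a : Fin m → ℝ} {J : Fin m → Fin m → ℕ}
    (hJ : ∑ p ∈ Finset.univ.filter (fun p : Fin m × Fin m => p.1 ≤ p.2), J p.1 p.2 = 0) :
    lambdaJ K E m a J = 1 :=
  Finset.prod_eq_one fun p hp => by rw [Finset.sum_eq_zero_iff.mp hJ p hp, pow_zero]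

theorem Finset.exists_eq_one_of_sum_eq_one {ι : Type*} {s : Finset ι} {f : ι → ℕ}
    (hf : ∑ i ∈ s, f i = 1) : ∃ i ∈ s, f i = 1 ∧ ∀ j ∈ s, j ≠ i → f j = 0 := by
  classical
  obtain ⟨i, hi, hi0⟩ := Finset.exists_ne_zero_of_sum_ne_zero (hf.trans_ne one_ne_zero)
  have hadd := Finset.add_sum_erase s f hi
  have hrest : ∑ j ∈ s.erase i, f j = 0 := by lia
  exact ⟨i, hi, by lia, fun j hj hji =>
    Finset.sum_eq_zero_iff.mp hrest j (Finset.mem_erase.mpr ⟨hji, hj⟩)⟩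

theorem lambdaJ_ne_of_sum_eq_one {K : ℕ} (hK : 0 < K) {E : ℝ} {m : ℕ} {a : Fin m → ℝ}
    (h : ∀ k, |E - a k| < Real.sqrt K) {J : Fin m → Fin m → ℕ}
    (hJ : ∑ p ∈ Finset.univ.filter (fun p : Fin m × Fin m => p.1 ≤ p.2), J p.1 p.2 = 1) :
    lambdaJ K E m a J ≠ 1 / (K : ℂ) := by
  obtain ⟨p, hp, hp1, hq⟩ := Finset.exists_eq_one_of_sum_eq_one hJ
  rw [lambdaJ, Finset.prod_eq_single_of_mem p hp
    (fun q hqm hqp => by rw [hq q hqm hqp, pow_zero]), hp1, pow_one]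
  exact four_mul_AEentry_mul_AEentry_ne hK (h _) (h _)

/-- If `|E − a_k| < √K` for all `k`, then for all `J, J′` one has
`λ_J · conj(λ_{J′}) ≠ 1/K`. -/
theorem lambdaJ_mul_conj_ne_inv_K (K : ℕ) (hK : 2 ≤ K) (E : ℝ) (m : ℕ)
    (a : Fin m → ℝ) (h : ∀ k, |E - a k| < Real.sqrt K)
    (J J' : Fin m → Fin m → ℕ) :
    lambdaJ K E m a J * (starRingEnd ℂ) (lambdaJ K E m a J') ≠ 1 / (K : ℂ) := by
  intro heq
  have hK0 : 0 < K := by lia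
  have hK1 : (1 : ℝ) < K := by exact_mod_cast hK
  have hnorm := congrArg norm heq
  rw [norm_mul, RCLike.norm_conj, norm_lambdaJ hK0 h, norm_lambdaJ hK0 h, ← pow_add, norm_div,
    norm_one, Complex.norm_natCast] at hnorm
  have hsum := pow_right_injective₀ (by positivity)
    (div_lt_one (by positivity) |>.mpr hK1).ne (hnorm.trans (pow_one _).symm)
  rcases Nat.add_eq_one_iff.mp hsum with ⟨h0, h1⟩ | ⟨h1, h0⟩
  · rw [lambdaJ_eq_one h0, one_mul] at heq
    refine lambdaJ_ne_of_sum_eq_one hK0 h h1 ?_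
    simpa using congrArg (starRingEnd ℂ) heq
  · rw [lambdaJ_eq_one h0, map_one, mul_one] at heq
    exact lambdaJ_ne_of_sum_eq_one hK0 h h1 heq
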